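/- arXiv:1305.4074 — 3 statements merged into one kernel-verified Lean document; each statement's English description precedes it below -/
import Mathlib

section
/- Let E be a real Hilbert space, φ a smooth flow on E, N a compact set with S = Inv(N,φ) ⊆ interior(N), and f: E → ℝ a smooth function that is constant on S and satisfies (d/dt)|_{t=0} f(φ(t,x)) < 0 for all x ∈ N \ S (a smooth Lyapunov function for (S,φ) with the Lyapunov property with respect to N). Let ψ: ℝ × E → E be a negative gradient flow of f. Then N is an isolating neighborhood for ψ, and Inv(N,ψ) = crit(f) ∩ N ⊆ S. -/
open Set

open Filter Topology

/-- A solution of an autonomous ODE that meets a zero of the vector field is constant. -/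
theorem eq_of_hasDerivAt_of_map_eq_zero {E : Type*} [NormedAddCommGroup E] [NormedSpace ℝ E]
    {v : E → E} {x : E} (hv : ContDiffAt ℝ 1 v x) (hx : v x = 0) {γ : ℝ → E}
    (hγ : ∀ t, HasDerivAt γ (v (γ t)) t) {t₀ : ℝ} (h₀ : γ t₀ = x) (t : ℝ) : γ t = x := by
  have hcont : Continuous γ := continuous_iff_continuousAt.2 fun t => (hγ t).continuousAt
  obtain ⟨K, s, hs, hK⟩ := hv.exists_lipschitzOnWith
  have hclopen : IsClopen {t | γ t = x} := by
    refine ⟨isClosed_eq hcont continuous_const, isOpen_iff_mem_nhds.2 fun t₁ ht₁ => ?_⟩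
    have hmem : ∀ᶠ t in 𝓝 t₁, γ t ∈ s :=
      hcont.continuousAt.eventually (by rwa [show γ t₁ = x from ht₁])
    refine ODE_solution_unique_of_eventually (v := fun _ => v) (s := fun _ => s) (K := K)
      (g := fun _ => x) (Eventually.of_forall fun _ => hK)
      (hmem.mono fun t ht => ⟨hγ t, ht⟩) (Eventually.of_forall fun t => ⟨?_, mem_of_mem_nhds hs⟩) ht₁
    simpa [hx] using hasDerivAt_const t x
  have huniv := hclopen.eq_univ ⟨t₀, h₀⟩
  exact huniv.ge (mem_univ t)

section GradientFlow

variable {E : Type*} [NormedAddCommGroup E] [InnerProductSpace ℝ E] [CompleteSpace E]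

theorem ContDiff.gradient {f : E → ℝ} {n m : WithTop ℕ∞} (hf : ContDiff ℝ n f)
    (hmn : m + 1 ≤ n) : ContDiff ℝ m (gradient f) :=
  (InnerProductSpace.toDual ℝ E).symm.toContinuousLinearEquiv.contDiff.comp
    (hf.fderiv_right hmn)

/-- The derivative of a function along a curve following its negative gradient. -/
theorem HasDerivAt.comp_neg_gradient {f : E → ℝ} {γ : ℝ → E} {t : ℝ}
    (hf : DifferentiableAt ℝ f (γ t)) (hγ : HasDerivAt γ (-gradient f (γ t)) t) :
    HasDerivAt (fun s => f (γ s)) (-‖gradient f (γ t)‖ ^ 2) t := by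
  have h := hf.hasGradientAt.hasFDerivAt.comp_hasDerivAt t hγ
  rwa [InnerProductSpace.toDual_apply_apply, inner_neg_right, real_inner_self_eq_norm_sq] at h

/-- Along a negative gradient curve in a compact set, `f` is bounded below by its value on
critical points, provided that value is unique. -/
theorem le_of_neg_gradient_curve {f : E → ℝ} (hf : ContDiff ℝ 1 f) {N : Set E}
    (hN : IsCompact N) {c : ℝ} (hc : ∀ x ∈ N, gradient f x = 0 → f x = c) {γ : ℝ → E}
    (hγN : ∀ t, γ t ∈ N) (hγ : ∀ t, HasDerivAt γ (-gradient f (γ t)) t) (t : ℝ) :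
    c ≤ f (γ t) := by
  have hg : ∀ t, HasDerivAt (fun s => f (γ s)) (-‖gradient f (γ t)‖ ^ 2) t := fun t =>
    (hγ t).comp_neg_gradient (hf.differentiable one_ne_zero _)
  have hgcont : Continuous fun s => f (γ s) :=
    continuous_iff_continuousAt.2 fun t => (hg t).continuousAt
  have hanti : Antitone fun s => f (γ s) :=
    antitone_of_deriv_nonpos (fun t => (hg t).differentiableAt) fun t => by
      rw [(hg t).deriv]; nlinarith [sq_nonneg ‖gradient f (γ t)‖]
  have hbdd : BddBelow (range fun s => f (γ s)) :=
    (hN.image hf.continuous).bddBelow.mono (by rintro _ ⟨s, rfl⟩; exact ⟨_, hγN s, rfl⟩)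
  have hlim := tendsto_atTop_ciInf hanti hbdd
  have hmvt : ∀ n : ℕ, ∃ τ ∈ Ioo (n : ℝ) (n + 1),
      -‖gradient f (γ τ)‖ ^ 2 = f (γ (n + 1)) - f (γ n) := fun n => by
    obtain ⟨τ, hτ, h⟩ := exists_hasDerivAt_eq_slope (fun s => f (γ s)) _ (lt_add_one (n : ℝ))
      hgcont.continuousOn fun t _ => hg t
    exact ⟨τ, hτ, by simpa using h⟩
  choose τ hτ hτeq using hmvt
  have hsq : Tendsto (fun n => -‖gradient f (γ (τ n))‖ ^ 2) atTop (𝓝 0) := by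
    simp_rw [hτeq]
    simpa using (hlim.comp (tendsto_natCast_atTop_atTop.atTop_add
      (tendsto_const_nhds (x := (1 : ℝ))))).sub (hlim.comp tendsto_natCast_atTop_atTop)
  obtain ⟨y, hyN, k, hk, hy⟩ := hN.tendsto_subseq fun n => hγN (τ n)
  have hycrit : gradient f y = 0 := by
    have hgrad : Continuous (gradient f) := (hf.gradient (m := 0) (by simp)).continuous
    have h := tendsto_nhds_unique ((hgrad.norm.pow 2).neg.continuousAt.tendsto.comp hy)
      (hsq.comp hk.tendsto_atTop)
    simpa using h
  rw [← hc y hyN hycrit]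
  refine le_of_tendsto (hf.continuous.continuousAt.tendsto.comp hy) ?_
  filter_upwards [(tendsto_natCast_atTop_atTop.comp hk.tendsto_atTop).eventually_ge_atTop t]
    with n hn
  exact hanti (hn.trans (hτ (k n)).1.le)

end GradientFlow

/-- Let `f` be a smooth Lyapunov function for the isolated invariant set `S`
of the smooth flow `φ` on a real Hilbert space `E`, with the Lyapunov property with respect
to the compact isolating neighborhood `N`.  If `ψ` is a negative gradient flow of `f`, then
`N` is an isolating neighborhood for `ψ` and `Inv(N, ψ) = crit(f) ∩ N ⊆ S`. -/
theorem statement4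
    {E : Type*} [NormedAddCommGroup E] [InnerProductSpace ℝ E] [CompleteSpace E]
    (φ : ℝ × E → E)
    (hφsmooth : ContDiff ℝ (⊤ : ℕ∞) φ)
    (hφ0 : ∀ x, φ (0, x) = x)
    (hφgrp : ∀ t s x, φ (t, φ (s, x)) = φ (t + s, x))
    (N S : Set E) (hNcpt : IsCompact N)
    (hInv : {x ∈ N | ∀ t, φ (t, x) ∈ N} = S)
    (hiso : S ⊆ interior N)
    (f : E → ℝ) (hfsmooth : ContDiff ℝ (⊤ : ℕ∞) f)
    (hfconst : ∃ c, ∀ x ∈ S, f x = c)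
    (hflyap : ∀ x ∈ N \ S, deriv (fun t => f (φ (t, x))) 0 < 0)
    (ψ : ℝ × E → E)
    (hψ0 : ∀ x, ψ (0, x) = x)
    (hψgrp : ∀ t s x, ψ (t, ψ (s, x)) = ψ (t + s, x))
    (hψode : ∀ t x, HasDerivAt (fun s => ψ (s, x)) (-(gradient f (ψ (t, x)))) t) :
    {x ∈ N | ∀ t, ψ (t, x) ∈ N} ⊆ interior N ∧
    {x ∈ N | ∀ t, ψ (t, x) ∈ N} = {x | gradient f x = 0} ∩ N ∧
    {x | gradient f x = 0} ∩ N ⊆ S := by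
  obtain ⟨c, hc⟩ := hfconst
  have hf : ContDiff ℝ 1 f := hfsmooth.of_le (by exact_mod_cast le_top)
  have hdiff : Differentiable ℝ f := hf.differentiable one_ne_zero
  have hcritS : {x | gradient f x = 0} ∩ N ⊆ S := by
    rintro x ⟨hx, hxN⟩
    by_contra hxS
    have hφ : DifferentiableAt ℝ (fun t : ℝ => φ (t, x)) 0 :=
      ((hφsmooth.differentiable (by simp)).comp
        (differentiable_id.prodMk (differentiable_const x))).differentiableAt
    have hgrad : HasGradientAt f 0 (φ (0, x)) := by
      rw [hφ0, ← show gradient f x = 0 from hx]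
      exact (hdiff x).hasGradientAt
    have hderiv := (hgrad.hasFDerivAt.comp_hasDerivAt 0 hφ.hasDerivAt).deriv
    refine (hflyap x ⟨hxN, hxS⟩).ne ?_
    simpa [Function.comp_def] using hderiv
  have hcritc : ∀ x ∈ N, gradient f x = 0 → f x = c := fun x hxN hx => hc x (hcritS ⟨hx, hxN⟩)
  have hInvψ : {x ∈ N | ∀ t, ψ (t, x) ∈ N} = {x | gradient f x = 0} ∩ N := by
    refine Subset.antisymm ?_ ?_
    · rintro x ⟨hxN, hx⟩
      have hlow := le_of_neg_gradient_curve hf hNcpt hcritc hx (fun t => hψode t x)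
      have hneg : ∀ y, gradient (fun z => -f z) y = -gradient f y := fun y => by
        simp [gradient, fderiv_fun_neg]
      have hupp := le_of_neg_gradient_curve (f := fun z => -f z) (c := -c)
        (γ := fun t => ψ (-t, x)) hf.neg hNcpt
        (fun y hyN hy => by rw [hcritc y hyN (by simpa [hneg] using hy)]) (fun t => hx (-t))
        (fun t => by
          simpa [hneg, Function.comp_def] using
            (hψode (-t) x).scomp t (hasDerivAt_neg t))
      have hconst : (fun t => f (ψ (t, x))) = fun _ => c := funext fun t =>
        le_antisymm (by simpa using hupp (-t)) (hlow t)
      have hderiv := (hψode 0 x).comp_neg_gradient (hdiff _)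
      rw [hconst, hψ0] at hderiv
      exact ⟨by simpa using hderiv.unique (hasDerivAt_const 0 c), hxN⟩
    · rintro x ⟨hx, hxN⟩
      refine ⟨hxN, fun t => ?_⟩
      have hv : ContDiff ℝ 1 fun y => -gradient f y :=
        (hfsmooth.gradient (by
          exact WithTop.coe_le_coe.2 (le_top : (1 + 1 : ℕ∞) ≤ ⊤))).neg
      rw [eq_of_hasDerivAt_of_map_eq_zero (γ := fun s => ψ (s, x)) hv.contDiffAt
        (neg_eq_zero.2 hx) (fun s => hψode s x) (hψ0 x) t]
      exact hxN
  exact ⟨hInvψ ▸ hcritS.trans hiso, hInvψ, hcritS⟩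
end

section
/- Let M be a locally compact Hausdorff topological space and N ⊆ M a compact set. For a continuous map ψ: ℝ × M → M define Inv(N,ψ) = {x ∈ N : ψ(t,x) ∈ N for all t ∈ ℝ}. Then the set {ψ ∈ C(ℝ × M, M) : Inv(N,ψ) ⊆ interior(N)} is open in the compact-open topology on C(ℝ × M, M). In particular, if N is an isolating neighborhood for a flow φ, then N is an isolating neighborhood for every continuous flow sufficiently close to φ in the compact-open topology. -/
open Set Filter

/-- For compact `N`, the condition that every orbit starting in `N \ interior N` leaves `N`
is open in the compact-open topology. -/
theorem isOpen_setOf_inv_subset_interior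
    {M : Type*} [TopologicalSpace M] [LocallyCompactSpace M] [T2Space M]
    {N : Set M} (hN : IsCompact N) :
    IsOpen {ψ : C(ℝ × M, M) | {x ∈ N | ∀ t : ℝ, ψ (t, x) ∈ N} ⊆ interior N} := by
  rw [isOpen_iff_eventually]
  intro φ hφ
  have key : ∀ᶠ ψ : C(ℝ × M, M) in nhds φ, ∀ x ∈ N \ interior N, ∃ t : ℝ, ψ (t, x) ∉ N := by
    refine (hN.diff isOpen_interior).eventually_forall_of_forall_eventually ?_
    intro x hx
    obtain ⟨t, ht⟩ : ∃ t : ℝ, φ (t, x) ∉ N := by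
      by_contra! h
      exact hx.2 (hφ ⟨hx.1, h⟩)
    have hc : Continuous fun z : C(ℝ × M, M) × M => z.1 (t, z.2) := by fun_prop
    filter_upwards [hc.continuousAt.eventually (hN.isClosed.isOpen_compl.mem_nhds ht)] with z hz
    exact ⟨t, hz⟩
  filter_upwards [key] with ψ hψ x hx
  by_contra hxi
  obtain ⟨t, ht⟩ := hψ x ⟨hx.1, hxi⟩
  exact ht (hx.2 t)

/-- On a locally compact Hausdorff space `M` with compact `N ⊆ M`, the set
of continuous maps `ψ : ℝ × M → M` for which `Inv(N, ψ) ⊆ interior N` is open in the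
compact-open topology.  In particular, if `N` is an isolating neighborhood for a flow `φ`,
then `N` is an isolating neighborhood for every continuous flow sufficiently close to `φ`. -/
theorem statement8
    {M : Type*} [TopologicalSpace M] [LocallyCompactSpace M] [T2Space M]
    (N : Set M) (hNcpt : IsCompact N) :
    IsOpen {ψ : C(ℝ × M, M) | {x ∈ N | ∀ t : ℝ, ψ (t, x) ∈ N} ⊆ interior N} ∧
    ∀ φ : C(ℝ × M, M),
      (∀ x, φ (0, x) = x) →
      (∀ t s x, φ (t, φ (s, x)) = φ (t + s, x)) →
      {x ∈ N | ∀ t : ℝ, φ (t, x) ∈ N} ⊆ interior N →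
      ∀ᶠ ψ in nhds φ, {x ∈ N | ∀ t : ℝ, ψ (t, x) ∈ N} ⊆ interior N := by
  have h := isOpen_setOf_inv_subset_interior hNcpt
  exact ⟨h, fun _ _ _ hφ => h.mem_nhds hφ⟩
end

section
/- Let E be a real Hilbert space, N ⊆ E a nonempty compact set, and f: ℝ × E → ℝ a smooth function (a smooth homotopy of functions f_λ = f(λ,·)). Fix 0 < δ < 1/4 and let ω: ℝ → [0,1] be a smooth, even, 2-periodic function with ω ≡ 0 on [−δ, δ], ω ≡ 1 on [1−δ, 1], ω' < 0 on (−1+δ, −δ) and ω' > 0 on (δ, 1−δ). For r > 0 define F: E × ℝ → ℝ by F(x,μ) = f(ω(μ), x) + r(1 + cos(πμ)). If r·π·sin(πδ) > sup{ |ω'(μ) · (∂_λ f)(ω(μ), x)| : μ ∈ ℝ, x ∈ N }, then for every (x,μ) ∈ N × [−1,1] the total derivative of F vanishes at (x,μ) if and only if either μ = 0 and x is a critical point of f(0,·), or |μ| = 1 and x is a critical point of f(1,·). In particular, every critical point of F in N × [−1,1] has μ ∈ {−1, 0, 1}. -/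
open Set Filter Real

theorem hasDerivAt_slice_left {E : Type*} [NormedAddCommGroup E] [NormedSpace ℝ E]
    {f : ℝ × E → ℝ} {l : ℝ} {x : E} (hf : DifferentiableAt ℝ f (l, x)) :
    HasDerivAt (fun t => f (t, x)) (fderiv ℝ f (l, x) (1, 0)) l :=
  hf.hasFDerivAt.comp_hasDerivAt l ((hasDerivAt_id l).prodMk (hasDerivAt_const l x))

theorem fderiv_slice_right {E : Type*} [NormedAddCommGroup E] [NormedSpace ℝ E]
    {f : ℝ × E → ℝ} {l : ℝ} {x : E} (hf : DifferentiableAt ℝ f (l, x)) :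
    fderiv ℝ (fun y => f (l, y)) x = (fderiv ℝ f (l, x)).comp (ContinuousLinearMap.inr ℝ ℝ E) :=
  (hf.hasFDerivAt.comp x (hasFDerivAt_prodMk_right l x)).fderiv

/-- The function `(x, μ) ↦ f (ω μ, x) + g μ` is critical at `(x, μ)` iff both partial derivatives
vanish. -/
theorem fderiv_homotopy_add_eq_zero_iff {E : Type*} [NormedAddCommGroup E] [NormedSpace ℝ E]
    {f : ℝ × E → ℝ} {ω g : ℝ → ℝ} {g' : ℝ} {x : E} {μ : ℝ}
    (hf : DifferentiableAt ℝ f (ω μ, x)) (hω : DifferentiableAt ℝ ω μ) (hg : HasDerivAt g g' μ) :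
    fderiv ℝ (fun p : E × ℝ => f (ω p.2, p.1) + g p.2) (x, μ) = 0 ↔
      fderiv ℝ (fun y => f (ω μ, y)) x = 0 ∧
        deriv ω μ * deriv (fun l => f (l, x)) (ω μ) + g' = 0 := by
  have hsnd : HasFDerivAt (fun p : E × ℝ => p.2) (ContinuousLinearMap.snd ℝ E ℝ) (x, μ) :=
    hasFDerivAt_snd
  have hfst : HasFDerivAt (fun p : E × ℝ => p.1) (ContinuousLinearMap.fst ℝ E ℝ) (x, μ) :=
    hasFDerivAt_fst
  have hω' : HasFDerivAt (fun p : E × ℝ => ω p.2)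
      (deriv ω μ • ContinuousLinearMap.snd ℝ E ℝ) (x, μ) :=
    HasDerivAt.comp_hasFDerivAt (x, μ) (h₂ := ω) hω.hasDerivAt hsnd
  have hg' : HasFDerivAt (fun p : E × ℝ => g p.2)
      (g' • ContinuousLinearMap.snd ℝ E ℝ) (x, μ) :=
    HasDerivAt.comp_hasFDerivAt (x, μ) (h₂ := g) hg hsnd
  have hF : HasFDerivAt (fun p : E × ℝ => f (ω p.2, p.1))
      ((fderiv ℝ f (ω μ, x)).comp
        ((deriv ω μ • ContinuousLinearMap.snd ℝ E ℝ).prod (ContinuousLinearMap.fst ℝ E ℝ)))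
      (x, μ) :=
    HasFDerivAt.comp (x, μ) (g := f) hf.hasFDerivAt (hω'.prodMk hfst)
  rw [(hF.fun_add hg').fderiv, fderiv_slice_right hf, (hasDerivAt_slice_left hf).deriv]
  have key (s : ℝ) (v : E) : fderiv ℝ f (ω μ, x) (deriv ω μ * s, v) =
      s * (deriv ω μ * fderiv ℝ f (ω μ, x) (1, 0)) + fderiv ℝ f (ω μ, x) (0, v) := by
    have : ((deriv ω μ * s, v) : ℝ × E) = (s * deriv ω μ) • ((1, 0) : ℝ × E) + (0, v) := by
      simp [mul_comm]
    rw [this, map_add, map_smul, smul_eq_mul, mul_assoc]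
  constructor
  · intro h
    constructor
    · ext v
      have := DFunLike.congr_fun h (v, 0)
      simpa using this
    · have := DFunLike.congr_fun h (0, 1)
      have k := key 1 0
      simp only [mul_one, one_mul, Prod.mk_zero_zero, map_zero, add_zero] at k
      simpa [k] using this
  · rintro ⟨h1, h2⟩
    apply ContinuousLinearMap.ext
    rintro ⟨v, s⟩
    have h3 : fderiv ℝ f (ω μ, x) (0, v) = 0 := by simpa using DFunLike.congr_fun h1 v
    have : s * (deriv ω μ * fderiv ℝ f (ω μ, x) (1, 0)) + g' * s = 0 := by
      linear_combination s * h2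
    simpa [key, h3] using this

theorem bddAbove_periodic_homotopy {E : Type*} [NormedAddCommGroup E] [NormedSpace ℝ E]
    {N : Set E} (hN : IsCompact N) {f : ℝ × E → ℝ} (hf : ContDiff ℝ 1 f)
    {ω : ℝ → ℝ} (hω : ContDiff ℝ 1 ω) {T : ℝ} (hT : 0 < T) (hper : Function.Periodic ω T) :
    BddAbove {a : ℝ | ∃ μ : ℝ, ∃ x ∈ N,
      a = |deriv ω μ * deriv (fun l => f (l, x)) (ω μ)|} := by
  have hcont : Continuous fun p : ℝ × E =>
      |deriv ω p.1 * fderiv ℝ f (ω p.1, p.2) (1, 0)| := by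
    have h1 : Continuous (deriv ω) := hω.continuous_deriv le_rfl
    have h2 : Continuous (fderiv ℝ f) := hf.continuous_fderiv one_ne_zero
    have h3 : Continuous ω := hω.continuous
    fun_prop
  refine ((isCompact_Icc (a := (0 : ℝ)) (b := T)).prod hN |>.image hcont).bddAbove.mono ?_
  rintro a ⟨μ, x, hx, rfl⟩
  have hper' : Function.Periodic (deriv ω) T := fun y => by
    rw [← deriv_comp_add_const, funext hper]
  obtain ⟨y, hy, hxy⟩ :=
    (show Function.Periodic (fun t => (ω t, deriv ω t)) T from
      fun t => Prod.ext (hper t) (hper' t)).exists_mem_Ico₀ hT μ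
  obtain ⟨h1, h2⟩ := Prod.ext_iff.mp hxy
  refine ⟨(y, x), ⟨Ico_subset_Icc_self hy, hx⟩, ?_⟩
  simp only at h1 h2 ⊢
  rw [h1, h2, (hasDerivAt_slice_left (hf.differentiable one_ne_zero _)).deriv]

theorem sin_pi_mul_le_of_mem_Icc {δ t : ℝ} (hδ : 0 ≤ δ) (ht : t ∈ Icc δ (1 - δ)) :
    Real.sin (π * δ) ≤ Real.sin (π * t) := by
  obtain ⟨h1, h2⟩ := ht
  have aux {s : ℝ} (hs : δ ≤ s) (hs' : s ≤ 1 / 2) : Real.sin (π * δ) ≤ Real.sin (π * s) := by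
    apply Real.sin_le_sin_of_le_of_le_pi_div_two <;> nlinarith [Real.pi_pos]
  rcases le_total t (1 / 2) with h | h
  · exact aux h1 h
  · have := aux (s := 1 - t) (by linarith) (by linarith)
    rwa [show π * (1 - t) = π - π * t by ring, Real.sin_pi_sub] at this

/-- critical points of the continuation Morse function
`F (x, μ) = f (ω μ, x) + r (1 + cos (π μ))` on `N × [-1, 1]`.  If
`r·π·sin(πδ)` dominates `sup |ω'(μ) ∂_λ f(ω(μ), x)|`, then the total derivative of `F`
vanishes at `(x, μ) ∈ N × [-1,1]` iff `μ = 0` and `x ∈ crit f(0,·)`, or `|μ| = 1` and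
`x ∈ crit f(1,·)`. -/
theorem statement9
    {E : Type*} [NormedAddCommGroup E] [InnerProductSpace ℝ E] [CompleteSpace E]
    (N : Set E) (hNne : N.Nonempty) (hNcpt : IsCompact N)
    (f : ℝ × E → ℝ) (hfsmooth : ContDiff ℝ (⊤ : ℕ∞) f)
    (δ : ℝ) (hδ0 : 0 < δ) (hδ4 : δ < 1/4)
    (ω : ℝ → ℝ) (hωsmooth : ContDiff ℝ (⊤ : ℕ∞) ω)
    (hωeven : ∀ μ, ω (-μ) = ω μ)
    (hωper : ∀ μ, ω (μ + 2) = ω μ)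
    (hωrange : ∀ μ, ω μ ∈ Icc (0:ℝ) 1)
    (hω0 : ∀ μ ∈ Icc (-δ) δ, ω μ = 0)
    (hω1 : ∀ μ ∈ Icc (1 - δ) 1, ω μ = 1)
    (hωdec : ∀ μ ∈ Ioo (-1 + δ) (-δ), deriv ω μ < 0)
    (hωinc : ∀ μ ∈ Ioo δ (1 - δ), 0 < deriv ω μ)
    (r : ℝ) (hr : 0 < r)
    (hbound : sSup {a : ℝ | ∃ μ : ℝ, ∃ x ∈ N,
        a = |deriv ω μ * deriv (fun l => f (l, x)) (ω μ)|}
      < r * π * Real.sin (π * δ)) :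
    ∀ x ∈ N, ∀ μ ∈ Icc (-1 : ℝ) 1,
      (fderiv ℝ (fun p : E × ℝ => f (ω p.2, p.1) + r * (1 + Real.cos (π * p.2))) (x, μ) = 0 ↔
        (μ = 0 ∧ fderiv ℝ (fun y => f (0, y)) x = 0) ∨
        (|μ| = 1 ∧ fderiv ℝ (fun y => f (1, y)) x = 0)) := by
  intro x hx μ hμ
  have hωd : Differentiable ℝ ω := hωsmooth.differentiable (by simp)
  have hfd : Differentiable ℝ f := hfsmooth.differentiable (by simp)
  have hg : HasDerivAt (fun t => r * (1 + Real.cos (π * t))) (-(r * π * Real.sin (π * μ))) μ := by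
    have h := ((((hasDerivAt_id μ).const_mul π).cos).const_add 1).const_mul r
    exact h.congr_deriv (by simp; ring)
  rw [fderiv_homotopy_add_eq_zero_iff (g := fun t => r * (1 + Real.cos (π * t)))
    (hfd _) (hωd μ) hg]
  have hd0 (h : ω μ = 0) : deriv ω μ = 0 :=
    IsLocalMin.deriv_eq_zero (Eventually.of_forall fun t => h ▸ (hωrange t).1)
  have hd1 (h : ω μ = 1) : deriv ω μ = 0 :=
    IsLocalMax.deriv_eq_zero (Eventually.of_forall fun t => h ▸ (hωrange t).2)
  have habs : ω |μ| = ω μ := by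
    rcases abs_choice μ with h | h <;> simp [h, hωeven]
  have hsinabs : |Real.sin (π * μ)| = |Real.sin (π * |μ|)| := by
    rcases abs_choice μ with h | h <;> simp [h]
  have hμ1 : |μ| ≤ 1 := abs_le.mpr hμ
  have hrπ : 0 < r * π := mul_pos hr Real.pi_pos
  constructor
  · rintro ⟨hcrit, heq⟩
    have hzero (h : deriv ω μ = 0) : Real.sin (π * |μ|) = 0 := by
      rw [h, zero_mul, zero_add, neg_eq_zero, mul_eq_zero] at heq
      rw [← abs_eq_zero, ← hsinabs, heq.resolve_left hrπ.ne', abs_zero]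
    rcases le_or_gt |μ| δ with h | h
    · have hω : ω μ = 0 := hω0 μ (abs_le.mp h)
      refine Or.inl ⟨?_, hω ▸ hcrit⟩
      by_contra hne
      have := Real.sin_pos_of_pos_of_lt_pi (x := π * |μ|)
        (mul_pos Real.pi_pos (abs_pos.mpr hne)) (by nlinarith [Real.pi_pos])
      exact this.ne' (hzero (hd0 hω))
    rcases le_or_gt (1 - δ) |μ| with h' | h'
    · have hω : ω μ = 1 := habs ▸ hω1 |μ| ⟨h', hμ1⟩
      refine Or.inr ⟨?_, hω ▸ hcrit⟩
      by_contra hne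
      have := Real.sin_pos_of_pos_of_lt_pi (x := π * |μ|)
        (mul_pos Real.pi_pos (by linarith))
        (by nlinarith [Real.pi_pos, lt_of_le_of_ne hμ1 hne])
      exact this.ne' (hzero (hd1 hω))
    · exfalso
      have hle := le_csSup (bddAbove_periodic_homotopy hNcpt (hfsmooth.of_le (by simp))
        (hωsmooth.of_le (by simp)) two_pos hωper) ⟨μ, x, hx, rfl⟩
      have hsin := (sin_pi_mul_le_of_mem_Icc hδ0.le ⟨h.le, h'.le⟩).trans (le_abs_self _)
      rw [← hsinabs] at hsin
      rw [add_neg_eq_zero.mp heq, abs_mul, abs_of_pos hrπ] at hle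
      have := mul_le_mul_of_nonneg_left hsin hrπ.le
      linarith
  · rintro (⟨rfl, hcrit⟩ | ⟨h, hcrit⟩)
    · have hω : ω 0 = 0 := hω0 0 ⟨by linarith, hδ0.le⟩
      exact ⟨hω.symm ▸ hcrit, by simp [hd0 hω]⟩
    · have hω : ω μ = 1 := by rw [← habs, h]; exact hω1 1 ⟨by linarith, le_rfl⟩
      have hsin : Real.sin (π * μ) = 0 := by
        rw [← abs_eq_zero, hsinabs, h]; simp
      exact ⟨hω.symm ▸ hcrit, by simp [hd1 hω, hsin]⟩
end
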